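/- For every real s > −1, the sequence of partial sums ∑_{k=3}^{n} (−1)^k · 2 k^{−s} sin(π/k) · exp(2πi(1/k − 2H_k)) converges to a limit in ℂ as n → ∞. -/

import Mathlib

open Real Filter Topology

/-- The `k`-th harmonic number `H_k = ∑_{m=1}^{k} 1/m`. -/
noncomputable def H (k : ℕ) : ℝ := ∑ m ∈ Finset.Icc 1 k, (1 : ℝ) / m

/-- Alternating sums of a null sequence of bounded variation converge. -/
theorem exists_tendsto_alternating_sum {b : ℕ → ℂ} (hb : Tendsto b atTop (𝓝 0))
    (hv : Summable fun k => ‖b (k + 1) - b k‖) :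
    ∃ L : ℂ, Tendsto (fun n => ∑ k ∈ Finset.range n, (-1 : ℂ) ^ k * b k) atTop (𝓝 L) := by
  have hsum : Summable fun k => (-1 : ℂ) ^ k * (b (k + 1) - b k) :=
    Summable.of_norm (by simpa using hv)
  have hnull : Tendsto (fun n => (-1 : ℂ) ^ n * b n) atTop (𝓝 0) := by
    rw [tendsto_zero_iff_norm_tendsto_zero] at hb ⊢
    simpa using hb
  refine ⟨_, (((hnull.const_sub (b 0)).sub hsum.hasSum.tendsto_sum_nat).div_const 2).congr
    fun n => ?_⟩
  induction n with
  | zero => simp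
  | succ n ih =>
    rw [Finset.sum_range_succ, Finset.sum_range_succ, ← ih]
    ring

/-- If `c` is bounded with increments `O(1/k)`, then `k ^ (-p) * c k` has bounded variation
for `p > 0`. -/
theorem summable_norm_sub_rpow_neg_mul {p B C : ℝ} (hp : 0 < p) {c : ℕ → ℂ}
    (hB : ∀ k, ‖c k‖ ≤ B) (hC : ∀ k, ‖c (k + 1) - c k‖ ≤ C / (k + 1 : ℝ)) :
    Summable fun k : ℕ => ‖((((k + 1 : ℕ) + 1 : ℝ) ^ (-p) : ℝ) : ℂ) * c (k + 1)
      - (((k + 1 : ℝ) ^ (-p) : ℝ) : ℂ) * c k‖ := by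
  have hanti : ∀ k : ℕ, ((k + 1 : ℕ) + 1 : ℝ) ^ (-p) ≤ (k + 1 : ℝ) ^ (-p) := fun k =>
    rpow_le_rpow_of_nonpos (by positivity) (by push_cast; linarith) (by linarith)
  have htele : Summable fun k : ℕ => (k + 1 : ℝ) ^ (-p) - ((k + 1 : ℕ) + 1 : ℝ) ^ (-p) := by
    refine summable_of_sum_range_le (c := 1) (fun k => sub_nonneg.2 (hanti k)) fun n => ?_
    rw [Finset.sum_range_sub' fun k : ℕ => (k + 1 : ℝ) ^ (-p)]
    have : 0 ≤ (n + 1 : ℝ) ^ (-p) := by positivity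
    simpa using this
  have hpow : Summable fun k : ℕ => (k + 1 : ℝ) ^ (-p - 1) := by
    have := (summable_nat_add_iff 1).2 (Real.summable_nat_rpow.2 (by linarith : -p - 1 < -1))
    simpa using this
  refine Summable.of_nonneg_of_le (fun _ => norm_nonneg _) (fun k => ?_)
    ((htele.mul_right B).add (hpow.mul_right C))
  have hk : (0 : ℝ) < k + 1 := by positivity
  have hnn : (0 : ℝ) ≤ (k + 1 : ℝ) ^ (-p) := by positivity
  calc _ = ‖((((k + 1 : ℝ) ^ (-p) : ℝ) : ℂ) * (c (k + 1) - c k))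
        - (((k + 1 : ℝ) ^ (-p) - ((k + 1 : ℕ) + 1 : ℝ) ^ (-p) : ℝ) : ℂ) * c (k + 1)‖ := by
        congr 1; push_cast; ring
    _ ≤ (k + 1 : ℝ) ^ (-p) * ‖c (k + 1) - c k‖
        + ((k + 1 : ℝ) ^ (-p) - ((k + 1 : ℕ) + 1 : ℝ) ^ (-p)) * ‖c (k + 1)‖ := by
        refine (norm_sub_le _ _).trans_eq ?_
        rw [norm_mul, norm_mul, Complex.norm_of_nonneg hnn,
          Complex.norm_of_nonneg (sub_nonneg.2 (hanti k))]
    _ ≤ (k + 1 : ℝ) ^ (-p) * (C / (k + 1))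
        + ((k + 1 : ℝ) ^ (-p) - ((k + 1 : ℕ) + 1 : ℝ) ^ (-p)) * B :=
        add_le_add (mul_le_mul_of_nonneg_left (hC k) hnn)
          (mul_le_mul_of_nonneg_left (hB _) (sub_nonneg.2 (hanti k)))
    _ = _ := by rw [rpow_sub_one hk.ne']; ring

theorem abs_mul_sin_pi_div_le {x : ℝ} (hx : 0 < x) : |x * sin (π / x)| ≤ π := by
  have h : |sin (π / x)| ≤ π / x := abs_sin_le_abs.trans_eq (abs_of_pos (by positivity))
  rw [abs_mul, abs_of_pos hx]
  calc x * |sin (π / x)| ≤ x * (π / x) := by gcongr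
    _ = π := by field_simp

theorem abs_mul_sin_pi_div_sub_le {x : ℝ} (hx : 0 < x) :
    |(x + 1) * sin (π / (x + 1)) - x * sin (π / x)| ≤ 2 * π / x := by
  have h1 : |sin (π / (x + 1))| ≤ π / (x + 1) :=
    abs_sin_le_abs.trans_eq (abs_of_pos (by positivity))
  have h2 : |sin (π / (x + 1)) - sin (π / x)| ≤ π / (x * (x + 1)) := by
    refine (abs_sin_sub_sin_le _ _).trans_eq ?_
    rw [abs_sub_comm, show π / x - π / (x + 1) = π / (x * (x + 1)) by field_simp; ring]
    exact abs_of_pos (by positivity)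
  calc _ = |sin (π / (x + 1)) + x * (sin (π / (x + 1)) - sin (π / x))| := by congr 1; ring
    _ ≤ π / (x + 1) + x * (π / (x * (x + 1))) := by
        refine (abs_add_le _ _).trans ?_
        rw [abs_mul, abs_of_pos hx]
        gcongr
    _ = 2 * π / (x + 1) := by field_simp; ring
    _ ≤ 2 * π / x := by gcongr; linarith

theorem Complex.norm_exp_ofReal_mul_I_sub_le (x y : ℝ) :
    ‖Complex.exp (x * Complex.I) - Complex.exp (y * Complex.I)‖ ≤ |x - y| := by
  have h := Real.norm_exp_I_mul_ofReal_sub_one_le (x := x - y)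
  calc _ = ‖Complex.exp (y * Complex.I) * (Complex.exp (Complex.I * ((x - y : ℝ) : ℂ)) - 1)‖ := by
        rw [mul_sub, ← Complex.exp_add, mul_one]
        congr 3; push_cast; ring
    _ ≤ |x - y| := by
        rw [norm_mul, Complex.norm_exp_ofReal_mul_I, one_mul]
        exact h

theorem H_succ (k : ℕ) : H (k + 1) = H k + 1 / (k + 1) := by
  simp [H, Finset.sum_Icc_succ_top]

/-- The phase of the `k`-th edge of the spiral. -/
noncomputable def spiralPhase (k : ℕ) : ℝ := 2 * π * (1 / k - 2 * H k)

theorem abs_spiralPhase_succ_sub_le {k : ℕ} (hk : 0 < k) :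
    |spiralPhase (k + 1) - spiralPhase k| ≤ 4 * π / k := by
  have hk' : (0 : ℝ) < k := by exact_mod_cast hk
  have h : spiralPhase (k + 1) - spiralPhase k = -(2 * π * (1 / (k + 1) + 1 / k)) := by
    simp only [spiralPhase, H_succ]; push_cast; ring
  rw [h, abs_neg, abs_of_pos (by positivity)]
  calc 2 * π * (1 / (k + 1) + 1 / k) ≤ 2 * π * (1 / k + 1 / k) := by gcongr; linarith
    _ = 4 * π / k := by ring

/-- The `k`-th edge of the spiral for `s = -1`, without the alternating sign. -/
noncomputable def spiralEdge (k : ℕ) : ℂ :=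
  ((2 * (k * sin (π / k)) : ℝ) : ℂ) * Complex.exp (spiralPhase k * Complex.I)

theorem norm_spiralEdge_le {k : ℕ} (hk : 0 < k) : ‖spiralEdge k‖ ≤ 2 * π := by
  have h := abs_mul_sin_pi_div_le (x := k) (by exact_mod_cast hk)
  rw [spiralEdge, norm_mul, Complex.norm_exp_ofReal_mul_I, mul_one, Complex.norm_real,
    Real.norm_eq_abs, abs_mul, abs_two]
  linarith

theorem norm_spiralEdge_succ_sub_le {k : ℕ} (hk : 0 < k) :
    ‖spiralEdge (k + 1) - spiralEdge k‖ ≤ (4 * π + 8 * π ^ 2) / k := by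
  have hk' : (0 : ℝ) < k := by exact_mod_cast hk
  have h1 := abs_mul_sin_pi_div_le hk'
  have h2 := abs_mul_sin_pi_div_sub_le hk'
  have h3 := (Complex.norm_exp_ofReal_mul_I_sub_le _ _).trans (abs_spiralPhase_succ_sub_le hk)
  calc _ = ‖((2 * ((k + 1) * sin (π / (k + 1)) - k * sin (π / k)) : ℝ) : ℂ)
          * Complex.exp (spiralPhase (k + 1) * Complex.I)
        + ((2 * (k * sin (π / k)) : ℝ) : ℂ) * (Complex.exp (spiralPhase (k + 1) * Complex.I)
          - Complex.exp (spiralPhase k * Complex.I))‖ := by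
        simp only [spiralEdge]; congr 1; push_cast; ring
    _ ≤ 2 * |(k + 1) * sin (π / (k + 1)) - k * sin (π / k)| + 2 * |k * sin (π / k)| *
        ‖Complex.exp (spiralPhase (k + 1) * Complex.I)
          - Complex.exp (spiralPhase k * Complex.I)‖ := by
        refine (norm_add_le _ _).trans_eq ?_
        rw [norm_mul, norm_mul, Complex.norm_exp_ofReal_mul_I, mul_one, Complex.norm_real,
          Complex.norm_real, Real.norm_eq_abs, Real.norm_eq_abs, abs_mul, abs_mul 2, abs_two]
    _ ≤ 2 * (2 * π / k) + 2 * π * (4 * π / k) := by gcongr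
    _ = _ := by ring

theorem inscribed_vertex_points_converge (s : ℝ) (hs : -1 < s) :
    ∃ L : ℂ, Tendsto
      (fun n : ℕ => ∑ k ∈ Finset.Icc 3 n,
        (-1 : ℂ) ^ k * ((2 * (k : ℝ) ^ (-s) * Real.sin (π / (k : ℝ)) : ℝ) : ℂ) *
          Complex.exp (2 * (π : ℂ) * Complex.I * (1 / (k : ℂ) - 2 * (H k : ℂ))))
      atTop (𝓝 L) := by
  have hp : 0 < s + 1 := by linarith
  have hnull : Tendsto (fun k : ℕ => (((k + 1 : ℝ) ^ (-(s + 1)) : ℝ) : ℂ) * spiralEdge (k + 1))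
      atTop (𝓝 0) := by
    have hpow : Tendsto (fun k : ℕ => (k + 1 : ℝ) ^ (-(s + 1))) atTop (𝓝 0) :=
      (tendsto_rpow_neg_atTop hp).comp
        (tendsto_atTop_add_const_right _ _ tendsto_natCast_atTop_atTop)
    refine squeeze_zero_norm (fun k => ?_) (zero_mul (2 * π) ▸ hpow.mul_const (2 * π))
    have hk : (0 : ℝ) ≤ (k + 1 : ℝ) ^ (-(s + 1)) := by positivity
    rw [norm_mul, Complex.norm_of_nonneg hk]
    exact mul_le_mul_of_nonneg_left (norm_spiralEdge_le k.succ_pos) hk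
  obtain ⟨L, hL⟩ := exists_tendsto_alternating_sum hnull
    (summable_norm_sub_rpow_neg_mul hp (c := fun k => spiralEdge (k + 1))
      (fun k => norm_spiralEdge_le k.succ_pos)
      fun k => by simpa using norm_spiralEdge_succ_sub_le k.succ_pos)
  have hterm : ∀ k : ℕ, (-1 : ℂ) ^ (k + 1)
        * ((2 * ((k + 1 : ℕ) : ℝ) ^ (-s) * Real.sin (π / ((k + 1 : ℕ) : ℝ)) : ℝ) : ℂ) *
          Complex.exp (2 * (π : ℂ) * Complex.I * (1 / ((k + 1 : ℕ) : ℂ) - 2 * (H (k + 1) : ℂ)))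
      = -((-1 : ℂ) ^ k * ((((k + 1 : ℝ) ^ (-(s + 1)) : ℝ) : ℂ) * spiralEdge (k + 1))) := by
    intro k
    have hk : (0 : ℝ) < k + 1 := by positivity
    have hpow : (k + 1 : ℝ) ^ (-s) = (k + 1 : ℝ) ^ (-(s + 1)) * (k + 1) := by
      rw [← rpow_add_one hk.ne']; congr 1; ring
    have hexp : 2 * (π : ℂ) * Complex.I * (1 / ((k + 1 : ℕ) : ℂ) - 2 * (H (k + 1) : ℂ))
        = spiralPhase (k + 1) * Complex.I := by
      simp only [spiralPhase]; push_cast; ring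
    rw [hexp, spiralEdge, Nat.cast_succ, hpow]
    push_cast
    ring
  refine ⟨-(L - ∑ k ∈ Finset.range 2,
    (-1 : ℂ) ^ k * ((((k + 1 : ℝ) ^ (-(s + 1)) : ℝ) : ℂ) * spiralEdge (k + 1))),
    ((hL.sub_const _).neg).congr' ?_⟩
  filter_upwards [eventually_ge_atTop 2] with n hn
  rw [← Finset.sum_Ico_eq_sub _ hn, ← Finset.sum_neg_distrib,
    ← Finset.Ico_add_one_right_eq_Icc, ← Finset.sum_Ico_add' _ 2 n 1]
  exact Finset.sum_congr rfl fun k _ => (hterm k).symm
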